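/- arXiv:2408.10224 — 6 statements merged into one kernel-verified Lean document; each statement's English description precedes it below -/
import Mathlib

section
/- For all natural numbers m, n, the two forms of the Weyl quantization rule for the monomial x^m p^n agree as operators on 𝒮(ℝ, ℂ): 2^{−m} Σ_{k=0}^{m} C(m,k) x̂^k p̂^n x̂^{m−k} = 2^{−n} Σ_{k=0}^{n} C(n,k) p̂^k x̂^m p̂^{n−k}, where C(a,b) denotes the binomial coefficient. -/
open SchwartzMap Finset

set_option synthInstance.maxHeartbeats 1000000

section SymmetrizedMultiplication

variable (R : Type*) {A : Type*} [CommRing R] [Ring A] [Algebra R A]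

/-- The symmetrized multiplication operator `b ↦ a * b + b * a`. -/
def symmMul (a : A) : Module.End R A :=
  LinearMap.mulLeft R a + LinearMap.mulRight R a

lemma symmMul_apply (a b : A) : symmMul R a b = a * b + b * a := rfl

lemma symmMul_pow_apply (a b : A) (m : ℕ) :
    (symmMul R a ^ m) b = ∑ k ∈ range (m + 1), (m.choose k : R) • (a ^ k * b * a ^ (m - k)) := by
  have h : Commute (LinearMap.mulLeft R a) (LinearMap.mulRight R a) :=
    LinearMap.commute_mulLeft_right a a
  rw [symmMul, h.add_pow, LinearMap.sum_apply]
  refine sum_congr rfl fun k _ => ?_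
  rw [← Nat.cast_comm, ← nsmul_eq_mul, LinearMap.smul_apply, LinearMap.pow_mulLeft,
    LinearMap.pow_mulRight, Module.End.mul_apply, LinearMap.mulRight_apply,
    LinearMap.mulLeft_apply, Nat.cast_smul_eq_nsmul, mul_assoc]

lemma symmMul_pow_apply_one (a : A) (m : ℕ) :
    (symmMul R a ^ m) 1 = (2 : R) ^ m • a ^ m := by
  induction m with
  | zero => simp
  | succ m ih =>
    rw [pow_succ', Module.End.mul_apply, ih, map_smul, symmMul_apply, ← pow_succ', ← pow_succ,
      ← two_smul R, smul_smul, ← pow_succ]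

/-- If the commutator of `a` and `b` is central, then the symmetrized multiplications by `a` and
by `b` commute. -/
lemma commute_symmMul {a b : A} (h : ∀ c, Commute (a * b - b * a) c) :
    Commute (symmMul R a) (symmMul R b) := by
  refine LinearMap.ext fun c => ?_
  have hc := (h c).eq
  simp only [Module.End.mul_apply, symmMul_apply]
  rw [← sub_eq_zero] at hc ⊢
  rw [← hc]
  noncomm_ring

end SymmetrizedMultiplication

/-- In an algebra over a field in which `2` is invertible, the two Weyl orderings of `a ^ m` and
`b ^ n` agree as soon as the commutator of `a` and `b` is central. -/
lemma weyl_ordering_eq {K A : Type*} [Field K] [NeZero (2 : K)] [Ring A] [Algebra K A] {a b : A}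
    (h : ∀ c, Commute (a * b - b * a) c) (m n : ℕ) :
    ((2 : K) ^ m)⁻¹ • ∑ k ∈ range (m + 1), (m.choose k : K) • (a ^ k * b ^ n * a ^ (m - k)) =
      ((2 : K) ^ n)⁻¹ •
        ∑ k ∈ range (n + 1), (n.choose k : K) • (b ^ k * a ^ m * b ^ (n - k)) := by
  have key := LinearMap.congr_fun ((commute_symmMul K h).pow_pow m n).eq 1
  rw [Module.End.mul_apply, Module.End.mul_apply, symmMul_pow_apply_one, symmMul_pow_apply_one,
    map_smul, map_smul, symmMul_pow_apply, symmMul_pow_apply] at key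
  have h2 (k : ℕ) : (2 : K) ^ k ≠ 0 := pow_ne_zero k two_ne_zero
  rw [inv_smul_eq_iff₀ (h2 m), smul_comm, ← key, inv_smul_smul₀ (h2 n)]

/-- The canonical commutation relation on Schwartz space. -/
lemma position_momentum_commutator (ℏ : ℝ) (X P : 𝓢(ℝ, ℂ) →L[ℂ] 𝓢(ℝ, ℂ))
    (hX : ∀ (f : 𝓢(ℝ, ℂ)) (x : ℝ), X f x = x * f x)
    (hP : ∀ (f : 𝓢(ℝ, ℂ)) (x : ℝ), P f x = -(Complex.I * ℏ) * deriv (⇑f) x) :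
    X * P - P * X = (Complex.I * ℏ) • (1 : 𝓢(ℝ, ℂ) →L[ℂ] 𝓢(ℝ, ℂ)) := by
  ext f x
  have hXf : ⇑(X f) = fun y : ℝ => (y : ℂ) * f y := funext (hX f)
  have hderiv : deriv (⇑(X f)) x = 1 * f x + x * deriv (⇑f) x := by
    rw [hXf]
    exact ((hasDerivAt_id x).ofReal_comp.mul f.differentiableAt.hasDerivAt).deriv
  change X (P f) x - P (X f) x = (Complex.I * ℏ) * f x
  rw [hX, hP, hP, hderiv]
  ring

/-- The two forms of the Weyl quantization rule for the monomial `x^m p^n`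
agree as operators on Schwartz space. -/
theorem weyl_quantization_two_forms (ℏ : ℝ) (hℏ : 0 < ℏ)
    (X P : 𝓢(ℝ, ℂ) →L[ℂ] 𝓢(ℝ, ℂ))
    (hX : ∀ (f : 𝓢(ℝ, ℂ)) (x : ℝ), X f x = x * f x)
    (hP : ∀ (f : 𝓢(ℝ, ℂ)) (x : ℝ), P f x = -(Complex.I * ℏ) * deriv (⇑f) x)
    (m n : ℕ) :
    ((2 : ℂ) ^ m)⁻¹ • ∑ k ∈ range (m + 1),
        (m.choose k : ℂ) • (X ^ k * P ^ n * X ^ (m - k)) =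
      ((2 : ℂ) ^ n)⁻¹ • ∑ k ∈ range (n + 1),
        (n.choose k : ℂ) • (P ^ k * X ^ m * P ^ (n - k)) := by
  refine weyl_ordering_eq (fun T => ?_) m n
  rw [position_momentum_commutator ℏ X P hX hP]
  exact (Commute.one_left T).smul_left _
end

section
/- For all natural numbers m, n and every real parameter τ, the two forms of the Shubin τ-quantization of the monomial x^m p^n agree as operators on 𝒮(ℝ, ℂ): Σ_{k=0}^{m} C(m,k) τ^k (1−τ)^{m−k} x̂^k p̂^n x̂^{m−k} = Σ_{k=0}^{n} C(n,k) τ^{n−k} (1−τ)^k p̂^k x̂^m p̂^{n−k}, where C(a,b) denotes the binomial coefficient. -/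
open SchwartzMap Finset

/-- The weighted average `a ↦ s • (x * a) + t • (a * x)` of left and right multiplication by `x`. -/
noncomputable def weightedMul {R A : Type*} [CommRing R] [Ring A] [Algebra R A] (s t : R) (x : A) :
    Module.End R A :=
  s • LinearMap.mulLeft R x + t • LinearMap.mulRight R x

section weightedMul

variable {R A : Type*} [CommRing R] [Ring A] [Algebra R A]

lemma weightedMul_apply (s t : R) (x a : A) :
    weightedMul s t x a = s • (x * a) + t • (a * x) := rfl

lemma weightedMul_pow_apply (s t : R) (x a : A) (m : ℕ) :
    (weightedMul s t x ^ m) a =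
      ∑ k ∈ range (m + 1), ((m.choose k : R) * s ^ k * t ^ (m - k)) • (x ^ k * a * x ^ (m - k)) := by
  have h : Commute (s • LinearMap.mulLeft R x) (t • LinearMap.mulRight R x) :=
    ((LinearMap.commute_mulLeft_right x x).smul_left s).smul_right t
  rw [weightedMul, h.add_pow, LinearMap.sum_apply]
  refine sum_congr rfl fun k _ => ?_
  rw [← Nat.cast_comm, ← nsmul_eq_mul, smul_pow, smul_pow, LinearMap.pow_mulLeft,
    LinearMap.pow_mulRight, mul_assoc (m.choose k : R), mul_smul, mul_smul, Nat.cast_smul_eq_nsmul]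
  simp [mul_assoc, smul_comm (t ^ (m - k))]

lemma weightedMul_pow_apply_one {s t : R} (hst : s + t = 1) (x : A) (m : ℕ) :
    (weightedMul s t x ^ m) 1 = x ^ m := by
  induction m with
  | zero => simp
  | succ m ih =>
    rw [pow_succ', Module.End.mul_apply, ih, weightedMul_apply, ← pow_succ', ← pow_succ,
      ← add_smul, hst, one_smul]

/-- If `x` and `p` have a scalar commutator, the contributions of left and right multiplications
to the commutator of the oppositely weighted averages cancel. -/
lemma commute_weightedMul (s t c : R) {x p : A} (h : x * p = p * x + c • 1) :
    Commute (weightedMul s t x) (weightedMul t s p) := by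
  ext a
  have hl : x * (p * a) = p * (x * a) + c • a := by
    rw [← mul_assoc, h, add_mul, mul_assoc, smul_mul_assoc, one_mul]
  have hr : a * x * p = a * p * x + c • a := by
    rw [mul_assoc, h, mul_add, mul_assoc, mul_smul_comm, mul_one]
  simp only [Module.End.mul_apply, weightedMul_apply, mul_add, add_mul, mul_smul_comm,
    smul_mul_assoc, hl, hr, smul_add, mul_assoc p, mul_assoc x]
  module

/-- The two forms of the `τ`-quantization of `x ^ m * p ^ n` agree in any algebra in which `x` and
`p` have a scalar commutator. -/
theorem sum_choose_smul_eq_of_commutator {s t c : R} (hst : s + t = 1) {x p : A}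
    (h : x * p = p * x + c • 1) (m n : ℕ) :
    ∑ k ∈ range (m + 1),
        ((m.choose k : R) * s ^ k * t ^ (m - k)) • (x ^ k * p ^ n * x ^ (m - k)) =
      ∑ k ∈ range (n + 1),
        ((n.choose k : R) * t ^ k * s ^ (n - k)) • (p ^ k * x ^ m * p ^ (n - k)) := by
  rw [← weightedMul_pow_apply, ← weightedMul_pow_apply,
    ← weightedMul_pow_apply_one (add_comm s t ▸ hst) p, ← weightedMul_pow_apply_one hst x,
    ← Module.End.mul_apply, ((commute_weightedMul s t c h).pow_pow m n).eq, Module.End.mul_apply]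

end weightedMul

/-- The canonical commutation relation for position and momentum on Schwartz space. -/
lemma position_mul_momentum (ℏ : ℝ) (X P : 𝓢(ℝ, ℂ) →L[ℂ] 𝓢(ℝ, ℂ))
    (hX : ∀ (f : 𝓢(ℝ, ℂ)) (x : ℝ), X f x = x * f x)
    (hP : ∀ (f : 𝓢(ℝ, ℂ)) (x : ℝ), P f x = -(Complex.I * ℏ) * deriv (⇑f) x) :
    X * P = P * X + (Complex.I * ℏ) • (1 : 𝓢(ℝ, ℂ) →L[ℂ] 𝓢(ℝ, ℂ)) := by
  ext f x
  have hderiv : deriv (⇑(X f)) x = f x + x * deriv (⇑f) x := by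
    rw [show ⇑(X f) = fun y : ℝ => (y : ℂ) * f y from funext (hX f)]
    refine ((hasDerivAt_id x).ofReal_comp.mul f.differentiableAt.hasDerivAt).deriv.trans ?_
    simp
  change X (P f) x = P (X f) x + (Complex.I * ℏ) * f x
  rw [hX, hP, hP, hderiv]
  ring

set_option synthInstance.maxHeartbeats 1000000 in
/-- The two forms of the Shubin τ-quantization of the monomial `x^m p^n`
agree as operators on Schwartz space. -/
theorem shubin_tau_quantization_two_forms (ℏ : ℝ) (hℏ : 0 < ℏ)
    (X P : 𝓢(ℝ, ℂ) →L[ℂ] 𝓢(ℝ, ℂ))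
    (hX : ∀ (f : 𝓢(ℝ, ℂ)) (x : ℝ), X f x = x * f x)
    (hP : ∀ (f : 𝓢(ℝ, ℂ)) (x : ℝ), P f x = -(Complex.I * ℏ) * deriv (⇑f) x)
    (m n : ℕ) (τ : ℝ) :
    ∑ k ∈ range (m + 1),
        ((m.choose k : ℂ) * (τ : ℂ) ^ k * ((1 : ℂ) - (τ : ℂ)) ^ (m - k)) •
          (X ^ k * P ^ n * X ^ (m - k)) =
      ∑ k ∈ range (n + 1),
        ((n.choose k : ℂ) * (τ : ℂ) ^ (n - k) * ((1 : ℂ) - (τ : ℂ)) ^ k) •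
          (P ^ k * X ^ m * P ^ (n - k)) := by
  rw [sum_choose_smul_eq_of_commutator (add_sub_cancel (τ : ℂ) 1)
    (position_mul_momentum ℏ X P hX hP) m n]
  exact sum_congr rfl fun k _ => by rw [mul_right_comm]
end

section
/- The Weyl quantization and the Born–Jordan quantization of the monomial x²p² differ by a constant multiple of ℏ² times the identity: (1/4)(x̂² p̂² + 2 x̂ p̂² x̂ + p̂² x̂²) − (1/3)(x̂² p̂² + x̂ p̂² x̂ + p̂² x̂²) = (1/6)ℏ²·id as operators on 𝒮(ℝ, ℂ). -/
open SchwartzMap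

/-- The canonical commutation relation, applied to a Schwartz function. -/
lemma momentum_position_apply (ℏ : ℝ) (X P : 𝓢(ℝ, ℂ) →L[ℂ] 𝓢(ℝ, ℂ))
    (hX : ∀ (f : 𝓢(ℝ, ℂ)) (x : ℝ), X f x = x * f x)
    (hP : ∀ (f : 𝓢(ℝ, ℂ)) (x : ℝ), P f x = -(Complex.I * ℏ) * deriv (⇑f) x)
    (f : 𝓢(ℝ, ℂ)) :
    P (X f) = X (P f) - (Complex.I * ℏ) • f := by
  ext x
  have hXf : (⇑(X f) : ℝ → ℂ) = fun y : ℝ => (y : ℂ) * f y := funext (hX f)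
  have hd : HasDerivAt (fun y : ℝ => (y : ℂ) * f y) (1 * f x + x * deriv (⇑f) x) x :=
    (HasDerivAt.ofReal_comp (hasDerivAt_id x)).mul f.differentiableAt.hasDerivAt
  rw [hP, hXf, hd.deriv, sub_apply, smul_apply, hX, hP, smul_eq_mul]
  ring

set_option synthInstance.maxHeartbeats 1000000 in
/-- The Weyl and Born–Jordan quantizations of `x²p²` differ by `(1/6)ℏ²·id`. -/
theorem weyl_sub_born_jordan_x2p2 (ℏ : ℝ) (hℏ : 0 < ℏ)
    (X P : 𝓢(ℝ, ℂ) →L[ℂ] 𝓢(ℝ, ℂ))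
    (hX : ∀ (f : 𝓢(ℝ, ℂ)) (x : ℝ), X f x = x * f x)
    (hP : ∀ (f : 𝓢(ℝ, ℂ)) (x : ℝ), P f x = -(Complex.I * ℏ) * deriv (⇑f) x) :
    (1 / 4 : ℂ) • (X ^ 2 * P ^ 2 + (2 : ℂ) • (X * P ^ 2 * X) + P ^ 2 * X ^ 2) -
        (1 / 3 : ℂ) • (X ^ 2 * P ^ 2 + X * P ^ 2 * X + P ^ 2 * X ^ 2) =
      ((1 / 6 : ℂ) * (ℏ : ℂ) ^ 2) • (1 : 𝓢(ℝ, ℂ) →L[ℂ] 𝓢(ℝ, ℂ)) := by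
  have hPX := momentum_position_apply ℏ X P hX hP
  have hsq : (ℏ : ℂ) ^ 2 = -(Complex.I * ℏ) ^ 2 := by
    rw [mul_pow, Complex.I_sq]
    ring
  rw [hsq]
  generalize Complex.I * (ℏ : ℂ) = c at hPX
  refine ContinuousLinearMap.ext fun f => ?_
  simp only [pow_two, sub_apply, add_apply, smul_apply, mul_apply_eq_comp,
    one_apply_eq_self, hPX, map_sub, map_smul]
  module
end

section
/- The Weyl quantization of the squared angular momentum l² = l₁² + l₂² + l₃² on ℝ³ exceeds l̂² by (3/2)ℏ²: as operators on 𝒮(ℝ³, ℂ), Σ_{(i,j)} [ x̂_i² p̂_j² + x̂_j² p̂_i² − 2 · ((x̂_ip̂_i + p̂_ix̂_i)/2) · ((x̂_jp̂_j + p̂_jx̂_j)/2) ] = l̂² + (3/2)ℏ²·id, where the sum runs over the pairs (i,j) ∈ {(2,3), (3,1), (1,2)} and l̂² = l̂₁² + l̂₂² + l̂₃² with l̂₁ = x̂₂p̂₃ − x̂₃p̂₂, l̂₂ = x̂₃p̂₁ − x̂₁p̂₃, l̂₃ = x̂₁p̂₂ − x̂₂p̂₁. (This discrepancy is the 'angular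 momentum dilemma'.) -/
open SchwartzMap

set_option synthInstance.maxHeartbeats 1000000

/-- The Weyl quantization of `l_{ij}² = (x_i p_j − x_j p_i)²` in one conjugate
pair of indices:
`x̂_i²p̂_j² + x̂_j²p̂_i² − 2·((x̂_ip̂_i+p̂_ix̂_i)/2)·((x̂_jp̂_j+p̂_jx̂_j)/2)`. -/
noncomputable def weylTermL2
    (X P : Fin 3 → (𝓢(EuclideanSpace ℝ (Fin 3), ℂ) →L[ℂ] 𝓢(EuclideanSpace ℝ (Fin 3), ℂ)))
    (i j : Fin 3) : 𝓢(EuclideanSpace ℝ (Fin 3), ℂ) →L[ℂ] 𝓢(EuclideanSpace ℝ (Fin 3), ℂ) :=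
  (X i) ^ 2 * (P j) ^ 2 + (X j) ^ 2 * (P i) ^ 2 -
    (2 : ℂ) • (((1 / 2 : ℂ) • (X i * P i + P i * X i)) *
      ((1 / 2 : ℂ) • (X j * P j + P j * X j)))

/-- In a complex algebra with canonical pairs `(x, p)` and `(y, q)`, the symmetrization of
`(x q - y p)²` differs from the square of `x q - y p` by a multiple of the identity. -/
theorem symmetrized_sq_eq_of_canonical_pairs {A : Type*} [Ring A] [Algebra ℂ A]
    {x y p q : A} {c : ℂ}
    (hxy : Commute x y) (hpq : Commute p q) (hxq : Commute x q) (hyp : Commute y p)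
    (hx : x * p - p * x = c • 1) (hy : y * q - q * y = c • 1) :
    x ^ 2 * q ^ 2 + y ^ 2 * p ^ 2 -
      (2 : ℂ) • (((1 / 2 : ℂ) • (x * p + p * x)) * ((1 / 2 : ℂ) • (y * q + q * y))) =
      (x * q - y * p) ^ 2 - (c ^ 2 / 2) • (1 : A) := by
  have hpx : p * x = x * p - c • 1 := by rw [← hx]; abel
  have hqy : q * y = y * q - c • 1 := by rw [← hy]; abel
  have h₁ : x * q * (x * q) = x ^ 2 * q ^ 2 := by
    rw [hxq.symm.mul_mul_mul_comm, sq, sq]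
  have h₂ : y * p * (y * p) = y ^ 2 * p ^ 2 := by
    rw [hyp.symm.mul_mul_mul_comm, sq, sq]
  have h₃ : x * q * (y * p) = x * p * (y * q) - c • (x * p) := by
    calc x * q * (y * p) = x * (q * y) * p := by noncomm_ring
      _ = x * (y * (q * p)) - c • (x * p) := by rw [hqy]; simp [mul_sub, sub_mul, mul_assoc]
      _ = x * ((y * p) * q) - c • (x * p) := by rw [← hpq.eq, mul_assoc y]
      _ = _ := by rw [hyp.eq]; simp only [mul_assoc]
  have h₄ : y * p * (x * q) = x * p * (y * q) - c • (y * q) := by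
    calc y * p * (x * q) = y * (p * x) * q := by noncomm_ring
      _ = (y * x) * (p * q) - c • (y * q) := by rw [hpx]; simp [mul_sub, sub_mul, mul_assoc]
      _ = x * ((y * p) * q) - c • (y * q) := by rw [← hxy.eq]; simp only [mul_assoc]
      _ = _ := by rw [hyp.eq]; simp only [mul_assoc]
  have h₅ : (x * q - y * p) ^ 2 =
      x * q * (x * q) - x * q * (y * p) - y * p * (x * q) + y * p * (y * p) := by noncomm_ring
  rw [h₅, h₁, h₂, h₃, h₄, hpx, hqy]
  simp only [mul_sub, sub_mul, mul_add, add_mul, smul_mul_assoc,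
    mul_smul_comm, one_mul, mul_one]
  module

section PositionMomentum

variable {ℏ : ℝ}
  {X P : Fin 3 → (𝓢(EuclideanSpace ℝ (Fin 3), ℂ) →L[ℂ] 𝓢(EuclideanSpace ℝ (Fin 3), ℂ))}

theorem commute_position
    (hX : ∀ (j : Fin 3) (f : 𝓢(EuclideanSpace ℝ (Fin 3), ℂ)) (x : EuclideanSpace ℝ (Fin 3)),
      X j f x = x j * f x) (j k : Fin 3) : Commute (X j) (X k) := by
  ext f x
  change X j (X k f) x = X k (X j f) x
  simp only [hX]
  ring

theorem commute_momentum
    (hP : ∀ (j : Fin 3) (f : 𝓢(EuclideanSpace ℝ (Fin 3), ℂ)) (x : EuclideanSpace ℝ (Fin 3)),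
      P j f x = -(Complex.I * ℏ) * fderiv ℝ (⇑f) x (EuclideanSpace.single j 1)) (j k : Fin 3) :
    Commute (P j) (P k) := by
  ext f x
  have hd : DifferentiableAt ℝ (fderiv ℝ f) x :=
    ((f.smooth 2).fderiv_right (m := 1) le_rfl).differentiable one_ne_zero x
  have hs (v w : EuclideanSpace ℝ (Fin 3)) :
      fderiv ℝ (fderiv ℝ f) x v w = fderiv ℝ (fderiv ℝ f) x w v :=
    ((f.smooth 2).contDiffAt.isSymmSndFDerivAt (by simp)).eq v w
  have hPP (j k : Fin 3) : P j (P k f) x = -(Complex.I * ℏ) * (-(Complex.I * ℏ) *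
      fderiv ℝ (fderiv ℝ f) x (EuclideanSpace.single j 1) (EuclideanSpace.single k 1)) := by
    rw [hP, funext (hP k f),
      ((hd.hasFDerivAt.clm_apply (hasFDerivAt_const _ x)).const_mul _).fderiv]
    simp
  change P j (P k f) x = P k (P j f) x
  rw [hPP, hPP, hs]

theorem position_mul_momentum_sub
    (hX : ∀ (j : Fin 3) (f : 𝓢(EuclideanSpace ℝ (Fin 3), ℂ)) (x : EuclideanSpace ℝ (Fin 3)),
      X j f x = x j * f x)
    (hP : ∀ (j : Fin 3) (f : 𝓢(EuclideanSpace ℝ (Fin 3), ℂ)) (x : EuclideanSpace ℝ (Fin 3)),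
      P j f x = -(Complex.I * ℏ) * fderiv ℝ (⇑f) x (EuclideanSpace.single j 1)) (j k : Fin 3) :
    X j * P k - P k * X j = (if j = k then Complex.I * ℏ else 0 : ℂ) • 1 := by
  ext f x
  have hc : HasFDerivAt (fun y : EuclideanSpace ℝ (Fin 3) => (y j : ℂ))
      (Complex.ofRealCLM ∘L EuclideanSpace.proj j) x :=
    (Complex.ofRealCLM ∘L (EuclideanSpace.proj j : EuclideanSpace ℝ (Fin 3) →L[ℝ] ℝ)).hasFDerivAt
  have hPX : P k (X j f) x = -(Complex.I * ℏ) *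
      (x j * fderiv ℝ f x (EuclideanSpace.single k 1) + f x * if j = k then 1 else 0) := by
    rw [hP, funext (hX j f), (hc.fun_mul f.differentiableAt.hasFDerivAt).fderiv]
    split_ifs with h <;> simp [h]
  change X j (P k f) x - P k (X j f) x = (if j = k then Complex.I * ℏ else 0 : ℂ) • f x
  rw [hPX, hX, hP]
  split_ifs <;> simp <;> ring

theorem weylTermL2_eq
    (hX : ∀ (j : Fin 3) (f : 𝓢(EuclideanSpace ℝ (Fin 3), ℂ)) (x : EuclideanSpace ℝ (Fin 3)),
      X j f x = x j * f x)
    (hP : ∀ (j : Fin 3) (f : 𝓢(EuclideanSpace ℝ (Fin 3), ℂ)) (x : EuclideanSpace ℝ (Fin 3)),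
      P j f x = -(Complex.I * ℏ) * fderiv ℝ (⇑f) x (EuclideanSpace.single j 1))
    {i j : Fin 3} (hij : i ≠ j) :
    weylTermL2 X P i j =
      (X i * P j - X j * P i) ^ 2 + ((1 / 2 : ℂ) * (ℏ : ℂ) ^ 2) •
        (1 : 𝓢(EuclideanSpace ℝ (Fin 3), ℂ) →L[ℂ] 𝓢(EuclideanSpace ℝ (Fin 3), ℂ)) := by
  have hcomm := position_mul_momentum_sub hX hP
  have hc : (Complex.I * ℏ) ^ 2 / 2 = -((1 / 2 : ℂ) * (ℏ : ℂ) ^ 2) := by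
    rw [mul_pow, Complex.I_sq]
    ring
  rw [weylTermL2, symmetrized_sq_eq_of_canonical_pairs (c := Complex.I * ℏ)
    (commute_position hX i j) (commute_momentum hP i j)
    (sub_eq_zero.mp (by simpa [hij] using hcomm i j))
    (sub_eq_zero.mp (by simpa [hij.symm] using hcomm j i))
    (by simpa using hcomm i i) (by simpa using hcomm j j), hc, neg_smul, sub_neg_eq_add]

end PositionMomentum

/-- The Weyl quantization of the squared angular momentum `l² = l₁² + l₂² + l₃²`
on `ℝ³` exceeds `l̂²` by `(3/2)ℏ²` (the "angular momentum dilemma").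
Indices are `0`-based: `X 0, P 0` correspond to `x̂₁, p̂₁`, etc., so the pairs
`(2,3), (3,1), (1,2)` become `(1,2), (2,0), (0,1)`. -/
theorem weyl_quantization_angular_momentum_squared (ℏ : ℝ) (hℏ : 0 < ℏ)
    (X P : Fin 3 → (𝓢(EuclideanSpace ℝ (Fin 3), ℂ) →L[ℂ] 𝓢(EuclideanSpace ℝ (Fin 3), ℂ)))
    (hX : ∀ (j : Fin 3) (f : 𝓢(EuclideanSpace ℝ (Fin 3), ℂ)) (x : EuclideanSpace ℝ (Fin 3)),
      X j f x = x j * f x)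
    (hP : ∀ (j : Fin 3) (f : 𝓢(EuclideanSpace ℝ (Fin 3), ℂ)) (x : EuclideanSpace ℝ (Fin 3)),
      P j f x = -(Complex.I * ℏ) * fderiv ℝ (⇑f) x (EuclideanSpace.single j 1)) :
    weylTermL2 X P 1 2 + weylTermL2 X P 2 0 + weylTermL2 X P 0 1 =
      ((X 1 * P 2 - X 2 * P 1) ^ 2 + (X 2 * P 0 - X 0 * P 2) ^ 2 +
          (X 0 * P 1 - X 1 * P 0) ^ 2) +
        ((3 / 2 : ℂ) * (ℏ : ℂ) ^ 2) •
          (1 : 𝓢(EuclideanSpace ℝ (Fin 3), ℂ) →L[ℂ] 𝓢(EuclideanSpace ℝ (Fin 3), ℂ)) := by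
  rw [weylTermL2_eq hX hP (by decide), weylTermL2_eq hX hP (by decide),
    weylTermL2_eq hX hP (by decide)]
  module
end

section
/- The Born–Jordan quantization of the square of the third component of the classical angular momentum l₃ = x₁p₂ − x₂p₁ satisfies, as operators on 𝒮(ℝ³, ℂ): x̂₁² p̂₂² + x̂₂² p̂₁² − (2/3) x̂₁p̂₁x̂₂p̂₂ − (1/3) x̂₁p̂₁p̂₂x̂₂ − (1/3) p̂₁x̂₁x̂₂p̂₂ − (2/3) p̂₁x̂₁p̂₂x̂₂ = l̂₃² + (2/3)ℏ²·id, where l̂₃ = x̂₁p̂₂ − x̂₂p̂₁. -/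
open SchwartzMap

/-- The Born–Jordan combination of two canonical pairs `(a, p)` and `(b, q)`, in any algebra. -/
theorem born_jordan_identity_of_commutation {A : Type*} [Ring A] [Algebra ℂ A] {a b p q : A}
    {c : ℂ} (hap : p * a = a * p - c • 1) (hbq : q * b = b * q - c • 1) (hab : b * a = a * b)
    (hpb : p * b = b * p) (hqa : q * a = a * q) (hqp : q * p = p * q) :
    a ^ 2 * q ^ 2 + b ^ 2 * p ^ 2 - (2 / 3 : ℂ) • (a * p * b * q) -
        (1 / 3 : ℂ) • (a * p * q * b) - (1 / 3 : ℂ) • (p * a * b * q) -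
        (2 / 3 : ℂ) • (p * a * q * b) =
      (a * q - b * p) ^ 2 - ((2 / 3 : ℂ) * c ^ 2) • (1 : A) := by
  have hap' (z : A) : p * (a * z) = a * (p * z) - c • z := by
    rw [← mul_assoc, hap, sub_mul, mul_assoc, smul_one_mul]
  have hbq' (z : A) : q * (b * z) = b * (q * z) - c • z := by
    rw [← mul_assoc, hbq, sub_mul, mul_assoc, smul_one_mul]
  have hab' (z : A) : b * (a * z) = a * (b * z) := by rw [← mul_assoc, hab, mul_assoc]
  have hpb' (z : A) : p * (b * z) = b * (p * z) := by rw [← mul_assoc, hpb, mul_assoc]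
  have hqa' (z : A) : q * (a * z) = a * (q * z) := by rw [← mul_assoc, hqa, mul_assoc]
  simp only [pow_two, mul_assoc, sub_mul, mul_sub, hap, hap', hbq, hbq', hab', hpb, hpb',
    hqa', hqp, mul_smul_comm, smul_mul_assoc, mul_one, one_mul]
  module

open LineDeriv in
/-- Directional derivatives of Schwartz functions commute. -/
theorem SchwartzMap.lineDerivOp_lineDerivOp_swap {E F : Type*} [NormedAddCommGroup E]
    [NormedSpace ℝ E] [NormedAddCommGroup F] [NormedSpace ℝ F] (v w : E) (f : 𝓢(E, F)) :
    ∂_{v} (∂_{w} f : 𝓢(E, F)) = (∂_{w} (∂_{v} f : 𝓢(E, F)) : 𝓢(E, F)) := by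
  have hd (x : E) : DifferentiableAt ℝ (fderiv ℝ f) x :=
    ((f.smooth 2).fderiv_right (m := 1) (by norm_num)).differentiable (by norm_num) x
  have hs (u u' x : E) :
      (∂_{u} (∂_{u'} f : 𝓢(E, F)) : 𝓢(E, F)) x = fderiv ℝ (fderiv ℝ f) x u u' := by
    have h : ⇑(∂_{u'} f : 𝓢(E, F)) = fun y ↦ fderiv ℝ f y u' := rfl
    rw [lineDerivOp_apply_eq_fderiv, h, fderiv_clm_apply (hd x) (differentiableAt_const u')]
    simp
  ext x
  rw [hs, hs]
  exact ((f.smooth 2).contDiffAt.isSymmSndFDerivAt (by simp)).eq v w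

set_option synthInstance.maxHeartbeats 1000000 in
/-- The Born–Jordan quantization of `l₃² = (x₁p₂ − x₂p₁)²` on `ℝ³`:
`x̂₁²p̂₂² + x̂₂²p̂₁² − (2/3)x̂₁p̂₁x̂₂p̂₂ − (1/3)x̂₁p̂₁p̂₂x̂₂ − (1/3)p̂₁x̂₁x̂₂p̂₂ − (2/3)p̂₁x̂₁p̂₂x̂₂
  = l̂₃² + (2/3)ℏ²·id`.
Indices are `0`-based: `X 0, P 0` correspond to `x̂₁, p̂₁`, etc. -/
theorem born_jordan_quantization_l3_squared (ℏ : ℝ) (hℏ : 0 < ℏ)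
    (X P : Fin 3 → (𝓢(EuclideanSpace ℝ (Fin 3), ℂ) →L[ℂ] 𝓢(EuclideanSpace ℝ (Fin 3), ℂ)))
    (hX : ∀ (j : Fin 3) (f : 𝓢(EuclideanSpace ℝ (Fin 3), ℂ)) (x : EuclideanSpace ℝ (Fin 3)),
      X j f x = x j * f x)
    (hP : ∀ (j : Fin 3) (f : 𝓢(EuclideanSpace ℝ (Fin 3), ℂ)) (x : EuclideanSpace ℝ (Fin 3)),
      P j f x = -(Complex.I * ℏ) * fderiv ℝ (⇑f) x (EuclideanSpace.single j 1)) :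
    (X 0) ^ 2 * (P 1) ^ 2 + (X 1) ^ 2 * (P 0) ^ 2 -
        (2 / 3 : ℂ) • (X 0 * P 0 * X 1 * P 1) - (1 / 3 : ℂ) • (X 0 * P 0 * P 1 * X 1) -
        (1 / 3 : ℂ) • (P 0 * X 0 * X 1 * P 1) - (2 / 3 : ℂ) • (P 0 * X 0 * P 1 * X 1) =
      (X 0 * P 1 - X 1 * P 0) ^ 2 +
        ((2 / 3 : ℂ) * (ℏ : ℂ) ^ 2) •
          (1 : 𝓢(EuclideanSpace ℝ (Fin 3), ℂ) →L[ℂ] 𝓢(EuclideanSpace ℝ (Fin 3), ℂ)) := by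
  have hPD (j : Fin 3) (f : 𝓢(EuclideanSpace ℝ (Fin 3), ℂ)) :
      P j f = (-(Complex.I * ℏ)) •
        (LineDeriv.lineDerivOp (EuclideanSpace.single j (1 : ℝ)) f :
          𝓢(EuclideanSpace ℝ (Fin 3), ℂ)) := by
    ext x
    simp [hP, lineDerivOp_apply_eq_fderiv]
  have hXX (j k : Fin 3) : X j * X k = X k * X j := by
    ext f x
    simp only [mul_apply_eq_comp, hX]
    ring
  have hPP (j k : Fin 3) : P j * P k = P k * P j := by
    ext1 f
    simp only [mul_apply_eq_comp, hPD, LineDeriv.lineDerivOp_smul]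
    rw [lineDerivOp_lineDerivOp_swap]
  have hPX (j k : Fin 3) :
      P j * X k = X k * P j - (if j = k then Complex.I * ℏ else 0) • 1 := by
    ext f x
    have h : ⇑(X k f) = fun y ↦ ((y k : ℝ) : ℂ) * f y := funext (hX k f)
    have hk : HasFDerivAt (fun y : EuclideanSpace ℝ (Fin 3) ↦ ((y k : ℝ) : ℂ))
        (Complex.ofRealCLM ∘L EuclideanSpace.proj k) x :=
      (Complex.ofRealCLM ∘L EuclideanSpace.proj k).hasFDerivAt
    simp only [mul_apply_eq_comp, sub_apply,
      smul_apply, one_apply_eq_self,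
      hX, hP, h, (hk.fun_mul f.differentiableAt.hasFDerivAt).fderiv]
    by_cases hjk : j = k
    · subst hjk
      simp
      ring
    · simp [hjk, Ne.symm hjk]
      ring
  have h := born_jordan_identity_of_commutation (c := Complex.I * ℏ)
    (by simpa using hPX 0 0) (by simpa using hPX 1 1) (hXX 1 0) (by simpa using hPX 0 1)
    (by simpa using hPX 1 0) (hPP 1 0)
  rw [h, sub_eq_add_neg, ← neg_smul, mul_pow, Complex.I_sq]
  congr 2
  ring
end

section
/- The Born–Jordan quantization of the squared angular momentum l² = l₁² + l₂² + l₃² on ℝ³ exceeds l̂² by 2ℏ²: as operators on 𝒮(ℝ³, ℂ), Σ_{(i,j)} [ x̂_i² p̂_j² + x̂_j² p̂_i² − (2/3) x̂_ip̂_ix̂_jp̂_j − (1/3) x̂_ip̂_ip̂_jx̂_j − (1/3) p̂_ix̂_ix̂_jp̂_j − (2/3) p̂_ix̂_ip̂_jx̂_j ] = l̂² + 2ℏ²·id, where the sum runs over the pairs (i,j) ∈ {(2,3), (3,1), (1,2)} and l̂² = l̂₁² + l̂₂² + l̂₃² with l̂₁ = x̂₂p̂₃ − x̂₃p̂₂,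 l̂₂ = x̂₃p̂₁ − x̂₁p̂₃, l̂₃ = x̂₁p̂₂ − x̂₂p̂₁. -/
open SchwartzMap

set_option synthInstance.maxHeartbeats 1000000

/-- The Born–Jordan quantization of `l_{ij}² = (x_i p_j − x_j p_i)²` in one
conjugate pair of indices:
`x̂_i²p̂_j² + x̂_j²p̂_i² − (2/3)x̂_ip̂_ix̂_jp̂_j − (1/3)x̂_ip̂_ip̂_jx̂_j − (1/3)p̂_ix̂_ix̂_jp̂_j
  − (2/3)p̂_ix̂_ip̂_jx̂_j`. -/
noncomputable def bjTermL2
    (X P : Fin 3 → (𝓢(EuclideanSpace ℝ (Fin 3), ℂ) →L[ℂ] 𝓢(EuclideanSpace ℝ (Fin 3), ℂ)))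
    (i j : Fin 3) : 𝓢(EuclideanSpace ℝ (Fin 3), ℂ) →L[ℂ] 𝓢(EuclideanSpace ℝ (Fin 3), ℂ) :=
  (X i) ^ 2 * (P j) ^ 2 + (X j) ^ 2 * (P i) ^ 2 -
    (2 / 3 : ℂ) • (X i * P i * X j * P j) - (1 / 3 : ℂ) • (X i * P i * P j * X j) -
    (1 / 3 : ℂ) • (P i * X i * X j * P j) - (2 / 3 : ℂ) • (P i * X i * P j * X j)

/-- The difference between the Born–Jordan quantization of `(x p' - x' p)²` and the square of
`x p' - x' p`, for two commuting canonical pairs `(x, p)` and `(x', p')` with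
`[x, p] = [x', p'] = c`. -/
theorem bornJordan_sub_sq_of_canonical {A : Type*} [Ring A] [Algebra ℂ A] {x x' p p' : A} {c : ℂ}
    (hxx : x' * x = x * x') (hpp : p' * p = p * p')
    (hp : p * x = x * p - c • 1) (hp' : p' * x' = x' * p' - c • 1)
    (hpx' : p * x' = x' * p) (hp'x : p' * x = x * p') :
    x ^ 2 * p' ^ 2 + x' ^ 2 * p ^ 2 - (2 / 3 : ℂ) • (x * p * x' * p') -
        (1 / 3 : ℂ) • (x * p * p' * x') - (1 / 3 : ℂ) • (p * x * x' * p') -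
        (2 / 3 : ℂ) • (p * x * p' * x') =
      (x * p' - x' * p) ^ 2 - (2 / 3 * c ^ 2) • 1 := by
  have left_swap {a b d : A} (h : a * b = d) (e : A) : a * (b * e) = d * e := by
    rw [← mul_assoc, h]
  simp only [pow_two, mul_assoc, mul_sub, sub_mul, hpp, hp, hp', hpx',
    left_swap hxx, left_swap hp, left_swap hp', left_swap hpx', left_swap hp'x,
    smul_mul_assoc, mul_smul_comm, mul_one, one_mul]
  module

section Canonical

variable {n : ℕ} {X P : Fin n → (𝓢(EuclideanSpace ℝ (Fin n), ℂ) →L[ℂ] 𝓢(EuclideanSpace ℝ (Fin n), ℂ))}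

/-- Position operators commute. -/
theorem position_mul_comm
    (hX : ∀ (j : Fin n) (f : 𝓢(EuclideanSpace ℝ (Fin n), ℂ)) (x : EuclideanSpace ℝ (Fin n)),
      X j f x = x j * f x) (i j : Fin n) : X i * X j = X j * X i := by
  ext f x
  simp only [mul_apply_eq_comp, hX]
  ring

/-- Momentum operators commute. -/
theorem momentum_mul_comm {c : ℂ}
    (hP : ∀ (j : Fin n) (f : 𝓢(EuclideanSpace ℝ (Fin n), ℂ)) (x : EuclideanSpace ℝ (Fin n)),
      P j f x = c * fderiv ℝ (⇑f) x (EuclideanSpace.single j 1)) (i j : Fin n) :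
    P i * P j = P j * P i := by
  ext f x
  have hdiff : Differentiable ℝ (fderiv ℝ (⇑f)) :=
    ((f.smooth 2).fderiv_right (m := 1) (by norm_num)).differentiable (by norm_num)
  have hPP (k l : Fin n) : P k (P l f) x = c * (c * fderiv ℝ (fderiv ℝ (⇑f)) x
      (EuclideanSpace.single k 1) (EuclideanSpace.single l 1)) := by
    have hPl : ⇑(P l f) = fun y ↦ c * fderiv ℝ (⇑f) y (EuclideanSpace.single l 1) :=
      funext (hP l f)
    rw [hP, hPl, fderiv_const_mul (by fun_prop),
      fderiv_clm_apply (hdiff x) (differentiableAt_const _)]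
    simp
  have hsymm : IsSymmSndFDerivAt ℝ (⇑f) x :=
    (f.smooth 2).contDiffAt.isSymmSndFDerivAt (by simp)
  simp only [mul_apply_eq_comp, hPP]
  rw [hsymm.eq]

/-- The canonical commutation relation `[P i, X j] = c δ i j`. -/
theorem momentum_mul_position {c : ℂ}
    (hX : ∀ (j : Fin n) (f : 𝓢(EuclideanSpace ℝ (Fin n), ℂ)) (x : EuclideanSpace ℝ (Fin n)),
      X j f x = x j * f x)
    (hP : ∀ (j : Fin n) (f : 𝓢(EuclideanSpace ℝ (Fin n), ℂ)) (x : EuclideanSpace ℝ (Fin n)),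
      P j f x = c * fderiv ℝ (⇑f) x (EuclideanSpace.single j 1)) (i j : Fin n) :
    P i * X j = X j * P i + (if i = j then c else 0) • 1 := by
  ext f x
  have hXf : ⇑(X j f) = fun y ↦ (y j : ℂ) * f y := funext (hX j f)
  have hcoord : HasFDerivAt (fun y : EuclideanSpace ℝ (Fin n) ↦ (y j : ℂ))
      (Complex.ofRealCLM ∘L EuclideanSpace.proj j) x :=
    (Complex.ofRealCLM ∘L EuclideanSpace.proj (𝕜 := ℝ) j).hasFDerivAt
  have hprod := (hcoord.mul f.differentiableAt.hasFDerivAt).fderiv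
  simp only [mul_apply_eq_comp, add_apply, smul_apply, one_apply_eq_self, hX, hP, hXf]
  erw [hprod]
  rcases eq_or_ne i j with rfl | hij
  · simp
    ring
  · simp [hij, hij.symm]
    ring

end Canonical

/-- The Born–Jordan quantization of the squared angular momentum
`l² = l₁² + l₂² + l₃²` on `ℝ³` exceeds `l̂²` by `2ℏ²`.
Indices are `0`-based: `X 0, P 0` correspond to `x̂₁, p̂₁`, etc., so the pairs
`(2,3), (3,1), (1,2)` become `(1,2), (2,0), (0,1)`. -/
theorem born_jordan_quantization_angular_momentum_squared (ℏ : ℝ) (hℏ : 0 < ℏ)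
    (X P : Fin 3 → (𝓢(EuclideanSpace ℝ (Fin 3), ℂ) →L[ℂ] 𝓢(EuclideanSpace ℝ (Fin 3), ℂ)))
    (hX : ∀ (j : Fin 3) (f : 𝓢(EuclideanSpace ℝ (Fin 3), ℂ)) (x : EuclideanSpace ℝ (Fin 3)),
      X j f x = x j * f x)
    (hP : ∀ (j : Fin 3) (f : 𝓢(EuclideanSpace ℝ (Fin 3), ℂ)) (x : EuclideanSpace ℝ (Fin 3)),
      P j f x = -(Complex.I * ℏ) * fderiv ℝ (⇑f) x (EuclideanSpace.single j 1)) :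
    bjTermL2 X P 1 2 + bjTermL2 X P 2 0 + bjTermL2 X P 0 1 =
      ((X 1 * P 2 - X 2 * P 1) ^ 2 + (X 2 * P 0 - X 0 * P 2) ^ 2 +
          (X 0 * P 1 - X 1 * P 0) ^ 2) +
        ((2 : ℂ) * (ℏ : ℂ) ^ 2) •
          (1 : 𝓢(EuclideanSpace ℝ (Fin 3), ℂ) →L[ℂ] 𝓢(EuclideanSpace ℝ (Fin 3), ℂ)) := by
  have hXX := position_mul_comm hX
  have hPP := momentum_mul_comm hP
  have hPX := momentum_mul_position hX hP
  have hterm (i j : Fin 3) (hij : i ≠ j) : bjTermL2 X P i j =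
      (X i * P j - X j * P i) ^ 2 - (2 / 3 * (Complex.I * ℏ) ^ 2) • 1 := by
    refine bornJordan_sub_sq_of_canonical (hXX j i) (hPP j i) ?_ ?_ ?_ ?_ <;>
      simp [hPX, hij, hij.symm, sub_eq_add_neg]
  rw [hterm 1 2 (by decide), hterm 2 0 (by decide), hterm 0 1 (by decide), mul_pow, Complex.I_sq]
  module
end
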